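/- For every non-null countable ordinal ξ there exists a set A of finite binary words (A ⊆ 2^{<ω}) such that the ω-power A^ω is a Π^0_ξ-complete subset of the Cantor space 2^ω; that is, A^ω belongs to Π^0_ξ(2^ω) and for every finite alphabet Y and every set E ⊆ Y^ω with E ∈ Π^0_ξ(Y^ω) there is a continuous map f : Y^ω → 2^ω with E = f^{-1}(A^ω). -/

import Mathlib

open Set

/-- The ω-power of a finitary language `V ⊆ α^{<ω}`: the set of infinite words that can be
cut into consecutive finite blocks, each belonging to `V`. -/
def omegaPower {α : Type*} (V : Set (List α)) : Set (ℕ → α) :=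
  { x | ∃ f : ℕ → ℕ, f 0 = 0 ∧ StrictMono f ∧
      ∀ k, (List.ofFn fun i : Fin (f (k + 1) - f k) => x (f k + i.val)) ∈ V }

/-- The classes `Σ⁰_ξ` of the Borel hierarchy on a topological space `X`:
`Σ⁰_1` is the class of open sets, and for `ξ > 1`, `Σ⁰_ξ` is the class of countable unions
of sets whose complements lie in `⋃_{γ < ξ} Σ⁰_γ`. -/
inductive SigmaO {X : Type*} [TopologicalSpace X] : Ordinal.{0} → Set X → Prop
  | isOpen (s : Set X) : IsOpen s → SigmaO 1 s
  | iUnion (ξ : Ordinal.{0}) (hξ : 1 < ξ) (f : ℕ → Set X) (g : ℕ → Ordinal.{0})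
      (hg : ∀ n, g n < ξ) (hf : ∀ n, SigmaO (g n) (f n)ᶜ) : SigmaO ξ (⋃ n, f n)

/-- The class `Π⁰_ξ` consists of the complements of the `Σ⁰_ξ` sets. -/
def PiO {X : Type*} [TopologicalSpace X] (ξ : Ordinal.{0}) (s : Set X) : Prop :=
  SigmaO ξ sᶜ
section Borel

variable {X : Type*} [TopologicalSpace X]

lemma sig_one_le {η : Ordinal.{0}} {s : Set X} (h : SigmaO η s) : 1 ≤ η := by
  cases h with
  | isOpen _ _ => exact le_rfl
  | iUnion _ hξ f g hg hf => exact hξ.le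

lemma sig_one_iff {s : Set X} : SigmaO 1 s ↔ IsOpen s := by
  constructor
  · intro h
    generalize ho : (1 : Ordinal.{0}) = o at h
    cases h with
    | isOpen _ h => exact h
    | iUnion _ hξ f g hg hf => exact absurd ho hξ.ne
  · exact SigmaO.isOpen s

lemma sig_cases {ξ : Ordinal.{0}} {s : Set X} (h : SigmaO ξ s) (hξ : 1 < ξ) :
    ∃ (f : ℕ → Set X) (g : ℕ → Ordinal.{0}), (∀ n, g n < ξ) ∧
      (∀ n, SigmaO (g n) (f n)ᶜ) ∧ s = ⋃ n, f n := by
  cases h with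
  | isOpen _ h => exact absurd hξ (lt_irrefl _)
  | iUnion _ hξ f g hg hf => exact ⟨f, g, hg, hf, rfl⟩

lemma sig_of_pi_lt {η ξ : Ordinal.{0}} {s : Set X} (h : PiO η s) (hlt : η < ξ) :
    SigmaO ξ s := by
  have h1 := sig_one_le h
  have := SigmaO.iUnion ξ (h1.trans_lt hlt) (fun _ => s) (fun _ => η) (fun _ => hlt) (fun _ => h)
  simpa [Set.iUnion_const] using this

lemma pi_of_sig_lt {η ξ : Ordinal.{0}} {s : Set X} (h : SigmaO η s) (hlt : η < ξ) :
    PiO ξ s := by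
  apply sig_of_pi_lt (η := η) _ hlt
  simpa [PiO] using h

lemma open_eq_iUnion_closed [TopologicalSpace.MetrizableSpace X] {U : Set X} (h : IsOpen U) :
    ∃ F : ℕ → Set X, (∀ n, IsClosed (F n)) ∧ U = ⋃ n, F n := by
  let _ := TopologicalSpace.metrizableSpaceMetric X
  obtain ⟨F, h1, _, h3, _⟩ := h.exists_iUnion_isClosed
  exact ⟨F, h1, h3.symm⟩

lemma sig_mono [TopologicalSpace.MetrizableSpace X] {η ξ : Ordinal.{0}} {s : Set X}
    (h : SigmaO η s) (hle : η ≤ ξ) : SigmaO ξ s := by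
  rcases hle.eq_or_lt with rfl | hlt
  · exact h
  have h1 := sig_one_le h
  rcases h1.eq_or_lt with rfl | h1
  · obtain ⟨F, hF, rfl⟩ := open_eq_iUnion_closed (sig_one_iff.1 h)
    exact SigmaO.iUnion ξ hlt F (fun _ => 1) (fun _ => hlt)
      (fun n => sig_one_iff.2 (hF n).isOpen_compl)
  · obtain ⟨f, g, hg, hf, rfl⟩ := sig_cases h h1
    exact SigmaO.iUnion ξ (h1.trans hlt) f g (fun n => (hg n).trans hlt) hf

lemma sig_iUnion {ξ : Ordinal.{0}} {s : ℕ → Set X} (h : ∀ n, SigmaO ξ (s n)) :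
    SigmaO ξ (⋃ n, s n) := by
  have h1 := sig_one_le (h 0)
  rcases h1.eq_or_lt with rfl | h1
  · exact sig_one_iff.2 (isOpen_iUnion fun n => sig_one_iff.1 (h n))
  · choose f g hg hf hs using fun n => sig_cases (h n) h1
    have := SigmaO.iUnion ξ h1 (fun n => f n.unpair.1 n.unpair.2)
      (fun n => g n.unpair.1 n.unpair.2) (fun n => hg _ _) (fun n => hf _ _)
    convert this using 1
    ext x
    simp only [hs, Set.mem_iUnion]
    constructor
    · rintro ⟨i, j, h⟩
      exact ⟨Nat.pair i j, by simpa using h⟩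
    · rintro ⟨n, h⟩
      exact ⟨_, _, h⟩

lemma sig_iUnion' {ι : Type*} [Countable ι] [Nonempty ι] {ξ : Ordinal.{0}} {s : ι → Set X}
    (h : ∀ n, SigmaO ξ (s n)) : SigmaO ξ (⋃ n, s n) := by
  obtain ⟨e, he⟩ := exists_surjective_nat ι
  rw [← he.iUnion_comp]
  exact sig_iUnion fun n => h _

lemma pi_iInter {ι : Type*} [Countable ι] [Nonempty ι] {ξ : Ordinal.{0}} {s : ι → Set X}
    (h : ∀ n, PiO ξ (s n)) : PiO ξ (⋂ n, s n) := by
  unfold PiO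
  rw [Set.compl_iInter]
  exact sig_iUnion' h

lemma sig_union {ξ : Ordinal.{0}} {s t : Set X} (hs : SigmaO ξ s) (ht : SigmaO ξ t) :
    SigmaO ξ (s ∪ t) := by
  rw [Set.union_eq_iUnion]
  exact sig_iUnion' (by intro b; cases b <;> assumption)

lemma pi_inter {ξ : Ordinal.{0}} {s t : Set X} (hs : PiO ξ s) (ht : PiO ξ t) :
    PiO ξ (s ∩ t) := by
  unfold PiO
  rw [Set.compl_inter]
  exact sig_union hs ht

lemma sig_inter_closed [TopologicalSpace.MetrizableSpace X] {ξ : Ordinal.{0}} {s K : Set X}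
    (hξ : 1 < ξ) (hs : SigmaO ξ s) (hK : IsClosed K) : SigmaO ξ (K ∩ s) := by
  obtain ⟨f, g, hg, hf, rfl⟩ := sig_cases hs hξ
  rw [Set.inter_iUnion]
  refine SigmaO.iUnion ξ hξ _ g hg fun n => ?_
  rw [Set.compl_inter]
  exact sig_union (sig_mono (sig_one_iff.2 hK.isOpen_compl) (sig_one_le (hf n))) (hf n)

lemma sig_preimage {Z : Type*} [TopologicalSpace Z] {ξ : Ordinal.{0}} {s : Set X}
    (hs : SigmaO ξ s) {f : Z → X} (hf : Continuous f) : SigmaO ξ (f ⁻¹' s) := by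
  induction hs with
  | isOpen s h => exact SigmaO.isOpen _ (h.preimage hf)
  | iUnion ξ hξ F g hg h ih =>
    rw [Set.preimage_iUnion]
    exact SigmaO.iUnion ξ hξ _ g hg fun n => ih n

lemma pi_preimage {Z : Type*} [TopologicalSpace Z] {ξ : Ordinal.{0}} {s : Set X}
    (hs : PiO ξ s) {f : Z → X} (hf : Continuous f) : PiO ξ (f ⁻¹' s) :=
  sig_preimage hs hf

lemma sig_extend {Z : Type*} [TopologicalSpace Z] {ξ : Ordinal.{0}} {f : Z → X}
    (hf : ∀ U : Set Z, IsOpen U → ∃ V : Set X, IsOpen V ∧ f ⁻¹' V = U)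
    {s : Set Z} (hs : SigmaO ξ s) : ∃ t : Set X, SigmaO ξ t ∧ f ⁻¹' t = s := by
  induction hs with
  | isOpen s h =>
    obtain ⟨V, hV, h⟩ := hf s h
    exact ⟨V, SigmaO.isOpen _ hV, h⟩
  | iUnion ξ hξ F g hg h ih =>
    choose t ht hts using ih
    refine ⟨⋃ n, (t n)ᶜ, SigmaO.iUnion ξ hξ _ g hg fun n => by simpa using ht n, ?_⟩
    rw [Set.preimage_iUnion]
    refine Set.iUnion_congr fun n => ?_
    rw [Set.preimage_compl, hts, compl_compl]

lemma sig_split [TopologicalSpace.MetrizableSpace X] {ξ : Ordinal.{0}} {s : Set X}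
    (hs : SigmaO ξ s) : ∃ (H : ℕ → Set X) (θ : ℕ → Ordinal.{0}), (∀ k, θ k ≤ ξ) ∧
      (∀ k, PiO (θ k) (H k)) ∧ s = ⋃ k, H k := by
  rcases (sig_one_le hs).eq_or_lt with rfl | h1
  · obtain ⟨F, hF, rfl⟩ := open_eq_iUnion_closed (sig_one_iff.1 hs)
    exact ⟨F, fun _ => 1, fun _ => le_rfl, fun n => sig_one_iff.2 (hF n).isOpen_compl, rfl⟩
  · obtain ⟨f, g, hg, hf, rfl⟩ := sig_cases hs h1
    exact ⟨f, g, fun n => (hg n).le, hf, rfl⟩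

/-- Representation of `Π⁰_ξ` sets as projections of closed sets with `Π⁰_ξ` partial sections. -/
lemma pi_rep [TopologicalSpace.MetrizableSpace X] (ξ : Ordinal.{0}) :
    ∀ E : Set X, PiO ξ E → ∃ C : Set (X × (ℕ → ℕ)), IsClosed C ∧
      (E = {x | ∃ z, (x, z) ∈ C}) ∧
      ∀ (F : Set ℕ) (z0 : ℕ → ℕ), IsLowerSet F →
        PiO ξ {x | ∃ z, (∀ i ∈ F, z i = z0 i) ∧ (x, z) ∈ C} := by
  induction ξ using WellFoundedLT.induction with
  | ind ξ IH =>
  intro E hE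
  rcases (sig_one_le hE).eq_or_lt with rfl | h1
  · have hc : IsClosed E := by
      have := sig_one_iff.1 hE
      exact isOpen_compl_iff.1 this
    refine ⟨Prod.fst ⁻¹' E, hc.preimage continuous_fst, ?_, ?_⟩
    · ext x; simp
    · intro F z0 _
      convert hE using 1
      ext x
      constructor
      · rintro ⟨z, _, h⟩; exact h
      · intro h; exact ⟨z0, fun _ _ => rfl, h⟩
  · obtain ⟨f, g, hg, hf, hEf⟩ := sig_cases hE h1
    choose H θ hθ hH hHf using fun n => sig_split (hf n)
    choose C hC hCE hCS using fun n k => IH (θ n k) ((hθ n k).trans_lt (hg n)) (H n k) (hH n k)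
    have key : ∀ x n k, x ∈ H n k ↔ ∃ z, (x, z) ∈ C n k := by
      intro x n k
      exact Set.ext_iff.1 (hCE n k) x
    have hmem : ∀ x, x ∈ E ↔ ∀ n, ∃ k, x ∈ H n k := by
      intro x
      have : x ∈ E ↔ ∀ n, x ∈ (f n)ᶜ := by
        rw [← not_iff_not, ← Set.mem_compl_iff, hEf]
        simp
      rw [this]
      refine forall_congr' fun n => ?_
      rw [hHf n]; simp
    let D : Set (X × (ℕ → ℕ)) := {q | ∀ n,
      (q.1, fun i => q.2 (Nat.pair n (i + 1))) ∈ C n (q.2 (Nat.pair n 0))}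
    -- general gluing
    have glue : ∀ (F : Set ℕ) (z0 : ℕ → ℕ) (x : X),
        (∃ z, (∀ i ∈ F, z i = z0 i) ∧ (x, z) ∈ D) ↔
        ∀ n, ∃ k w, (Nat.pair n 0 ∈ F → k = z0 (Nat.pair n 0)) ∧
          (∀ i, Nat.pair n (i + 1) ∈ F → w i = z0 (Nat.pair n (i + 1))) ∧ (x, w) ∈ C n k := by
      intro F z0 x
      constructor
      · rintro ⟨z, hz, hD⟩ n
        exact ⟨z (Nat.pair n 0), fun i => z (Nat.pair n (i + 1)), fun h => hz _ h,
          fun i h => hz _ h, hD n⟩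
      · intro h
        choose k w hk hw hC using h
        let z : ℕ → ℕ := fun m => match m.unpair.2 with
          | 0 => k m.unpair.1
          | i + 1 => w m.unpair.1 i
        have z1 : ∀ n, z (Nat.pair n 0) = k n := by intro n; simp [z]
        have z2 : ∀ n i, z (Nat.pair n (i + 1)) = w n i := by intro n i; simp [z]
        refine ⟨z, ?_, ?_⟩
        · intro m hm
          obtain ⟨n, j, rfl⟩ : ∃ n j, m = Nat.pair n j := ⟨_, _, (Nat.pair_unpair m).symm⟩
          cases j with
          | zero => rw [z1]; exact hk n hm
          | succ i => rw [z2]; exact hw n i hm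
        · intro n
          simp only [z1, z2]
          exact hC n
    refine ⟨D, ?_, ?_, ?_⟩
    · have : D = ⋂ n, {q | (q.1, fun i => q.2 (Nat.pair n (i + 1))) ∈ C n (q.2 (Nat.pair n 0))} := by
        ext q; simp [D]
      rw [this]
      refine isClosed_iInter fun n => ?_
      have : {q : X × (ℕ → ℕ) | (q.1, fun i => q.2 (Nat.pair n (i + 1))) ∈ C n (q.2 (Nat.pair n 0))}ᶜ
          = ⋃ k, ({q | q.2 (Nat.pair n 0) = k} ∩
            (fun q : X × (ℕ → ℕ) => (q.1, fun i => q.2 (Nat.pair n (i + 1)))) ⁻¹' (C n k)ᶜ) := by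
        ext q; simp
      rw [← isOpen_compl_iff, this]
      refine isOpen_iUnion fun k => IsOpen.inter ?_ ?_
      · exact (isOpen_discrete {k}).preimage
          (f := fun q : X × (ℕ → ℕ) => q.2 (Nat.pair n 0)) (by fun_prop)
      · exact (hC n k).isOpen_compl.preimage (by fun_prop)
    · ext x
      have := glue ∅ (fun _ => 0) x
      simp only [Set.mem_empty_iff_false, false_imp_iff, implies_true, true_and] at this
      rw [Set.mem_ofPred_eq, this, hmem]
      exact forall_congr' fun n => exists_congr fun k => key x n k
    · intro F z0 hF
      have : {x | ∃ z, (∀ i ∈ F, z i = z0 i) ∧ (x, z) ∈ D} = ⋂ n, {x | ∃ k w,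
          (Nat.pair n 0 ∈ F → k = z0 (Nat.pair n 0)) ∧
          (∀ i, Nat.pair n (i + 1) ∈ F → w i = z0 (Nat.pair n (i + 1))) ∧ (x, w) ∈ C n k} := by
        ext x
        simp only [Set.mem_iInter, Set.mem_ofPred_eq]
        exact glue F z0 x
      rw [this]
      refine pi_iInter fun n => ?_
      by_cases h0 : Nat.pair n 0 ∈ F
      · have hlow : IsLowerSet {i | Nat.pair n (i + 1) ∈ F} := by
          intro a b hab ha
          refine hF ?_ ha
          rcases hab.eq_or_lt with rfl | h
          · exact le_rfl
          · exact (Nat.pair_lt_pair_right n (by omega)).le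
        have := hCS n (z0 (Nat.pair n 0)) {i | Nat.pair n (i + 1) ∈ F}
          (fun i => z0 (Nat.pair n (i + 1))) hlow
        have h2 : PiO ξ _ := sig_mono this (((hθ n _).trans_lt (hg n)).le)
        convert h2 using 1
        ext x
        simp [h0]
      · have hno : ∀ i, Nat.pair n (i + 1) ∉ F := fun i hi =>
          h0 (hF (Nat.pair_lt_pair_right n (by omega)).le hi)
        have h2 : PiO ξ (f n)ᶜ := pi_of_sig_lt (hf n) (hg n)
        convert h2 using 1
        ext x
        rw [hHf n]
        simp [h0, hno, key]

end Borel

section Universal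

lemma closed_complete {Z : Type} [TopologicalSpace Z] {a b : Z} (hab : a ≠ b)
    (Y : Type) [TopologicalSpace Y] [DiscreteTopology Y] (E : Set (ℕ → Y)) (hE : IsClosed E) :
    ∃ f : (ℕ → Y) → (ℕ → Z), Continuous f ∧ E = f ⁻¹' {fun _ => a} := by
  classical
  refine ⟨fun y n => if ∃ y' ∈ E, ∀ i < n, y' i = y i then a else b, ?_, ?_⟩
  · refine continuous_pi fun n => ?_
    refine IsLocallyConstant.continuous ?_
    rw [IsLocallyConstant.iff_exists_open]
    intro y
    refine ⟨{y' | ∀ i ∈ Finset.range n, y' i = y i}, ?_, by simp, ?_⟩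
    · have : {y' : ℕ → Y | ∀ i ∈ Finset.range n, y' i = y i} =
          ⋂ i ∈ Finset.range n, (fun y' : ℕ → Y => y' i) ⁻¹' {y i} := by
        ext; simp
      rw [this]
      exact isOpen_biInter_finset fun i _ =>
        (isOpen_discrete {y i}).preimage (continuous_apply i)
    · intro y' hy'
      have : (∃ w ∈ E, ∀ i < n, w i = y' i) ↔ (∃ w ∈ E, ∀ i < n, w i = y i) := by
        refine exists_congr fun w => and_congr_right fun _ => forall₂_congr fun i hi => ?_
        rw [hy' i (Finset.mem_range.2 hi)]
      simp only [this]
  · ext y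
    constructor
    · intro h
      rw [Set.mem_preimage, Set.mem_singleton_iff]
      funext n
      rw [if_pos ⟨y, h, fun _ _ => rfl⟩]
    · intro h
      rw [Set.mem_preimage, Set.mem_singleton_iff] at h
      have h' : ∀ n, ∃ y' ∈ E, ∀ i < n, y' i = y i := by
        intro n
        by_contra hn
        have := congrFun h n
        simp only [if_neg hn] at this
        exact hab this.symm
      choose w hw hwy using h'
      refine hE.mem_of_tendsto (f := w) (b := Filter.atTop) ?_ (Filter.Eventually.of_forall hw)
      rw [tendsto_pi_nhds]
      intro i
      apply tendsto_const_nhds.congr'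
      filter_upwards [Filter.eventually_gt_atTop i] with n hn
      exact (hwy n i hn).symm

lemma enum_ordinals {ξ : Ordinal.{0}} (h1 : 1 < ξ) (hcount : ξ.card ≤ Cardinal.aleph0) :
    ∃ e : ℕ → Ordinal.{0}, (∀ i, 1 ≤ e i ∧ e i < ξ) ∧ ∀ η, 1 ≤ η → η < ξ → ∃ i, e i = η := by
  have hc : (Set.Ico 1 ξ).Countable := by
    refine Set.Countable.mono (s₂ := Set.Iio ξ) (fun x hx => hx.2) ?_
    rw [← Cardinal.le_aleph0_iff_set_countable, Cardinal.mk_Iio_ordinal]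
    simpa [← Ordinal.lift_card] using hcount
  obtain ⟨e, he⟩ := hc.exists_eq_range ⟨1, le_rfl, h1⟩
  refine ⟨e, fun i => ?_, fun η h1 h2 => ?_⟩
  · have : e i ∈ Set.Ico 1 ξ := he ▸ Set.mem_range_self i
    exact this
  · have : η ∈ Set.range e := he ▸ ⟨h1, h2⟩
    exact this

lemma exists_universal (ξ : Ordinal.{0}) (hξ : ξ ≠ 0) (hcount : ξ.card ≤ Cardinal.aleph0) :
    ∃ W : Set (ℕ → ℕ), (∃ w, w ∉ W) ∧ PiO ξ W ∧
      ∀ (Y : Type) [TopologicalSpace Y] [DiscreteTopology Y]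
        (E : Set (ℕ → Y)), PiO ξ E →
          ∃ f : (ℕ → Y) → (ℕ → ℕ), Continuous f ∧ E = f ⁻¹' W := by
  induction ξ using WellFoundedLT.induction with
  | ind ξ IH =>
  rcases (Order.one_le_iff_ne_zero.2 hξ).eq_or_lt with rfl | h1
  · refine ⟨{fun _ => 0}, ⟨fun _ => 1, ?_⟩, ?_, ?_⟩
    · intro h
      have := congrFun (Set.mem_singleton_iff.1 h) 0
      simp at this
    · exact sig_one_iff.2 isClosed_singleton.isOpen_compl
    · intro Y _ _ E hE
      exact closed_complete (zero_ne_one : (0 : ℕ) ≠ 1) Y E (isOpen_compl_iff.1 (sig_one_iff.1 hE))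
  · obtain ⟨e, he, hsurj⟩ := enum_ordinals h1 hcount
    have IH' := fun i => IH (e i) (he i).2 (Order.one_le_iff_ne_zero.1 (he i).1)
      ((Ordinal.card_le_card (he i).2.le).trans hcount)
    choose W hne hW hU using IH'
    choose w0 hw0 using hne
    refine ⟨{x | ∀ m : ℕ, (fun j => x (Nat.pair m j)) ∉ W m.unpair.2}, ?_, ?_, ?_⟩
    · -- some point of `W 0`
      obtain ⟨f, _, hf⟩ := hU 0 ℕ Set.univ (by
        have : SigmaO (e 0) (∅ : Set (ℕ → ℕ)) := sig_mono (sig_one_iff.2 isOpen_empty) (he 0).1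
        simpa [PiO] using this)
      have hp : f (fun _ => 0) ∈ W 0 := by
        have : (fun _ => 0) ∈ f ⁻¹' W 0 := hf ▸ Set.mem_univ _
        exact this
      refine ⟨fun n => f (fun _ => 0) n.unpair.2, fun h => h 0 ?_⟩
      simpa using hp
    · unfold PiO
      have : {x : ℕ → ℕ | ∀ m : ℕ, (fun j => x (Nat.pair m j)) ∉ W m.unpair.2}ᶜ =
          ⋃ m : ℕ, (fun x : ℕ → ℕ => fun j => x (Nat.pair m j)) ⁻¹' W m.unpair.2 := by
        ext x; simp
      rw [this]
      refine SigmaO.iUnion ξ h1 _ (fun m => e m.unpair.2) (fun m => (he _).2) fun m => ?_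
      exact pi_preimage (hW _) (by fun_prop)
    · intro Y _ _ E hE
      obtain ⟨f, g, hg, hf, hEf⟩ := sig_cases hE h1
      choose i hi using fun n => hsurj (g n) (sig_one_le (hf n)) (hg n)
      have hf' : ∀ n, PiO (e (i n)) (f n) := by
        intro n; rw [hi n]; exact hf n
      choose h hh hfh using fun n => hU (i n) Y (f n) (hf' n)
      classical
      refine ⟨fun y m => if m.unpair.1.unpair.2 = i m.unpair.1.unpair.1 then
        h m.unpair.1.unpair.1 y m.unpair.2 else w0 m.unpair.1.unpair.2 m.unpair.2, ?_, ?_⟩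
      · refine continuous_pi fun m => ?_
        by_cases hm : m.unpair.1.unpair.2 = i m.unpair.1.unpair.1
        · simp only [if_pos hm]
          exact (continuous_apply _).comp (hh _)
        · simp only [if_neg hm]
          exact continuous_const
      · ext y
        have hy : y ∈ E ↔ ∀ n, y ∉ f n := by
          rw [← not_iff_not, ← Set.mem_compl_iff, hEf]; simp
        rw [hy]
        simp only [Set.mem_preimage, Set.mem_ofPred_eq, Nat.unpair_pair]
        constructor
        · intro H m
          by_cases hm : m.unpair.2 = i m.unpair.1
          · simp only [hm, if_true]
            have := H m.unpair.1
            rw [hfh] at this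
            exact this
          · simp only [if_neg hm]
            exact hw0 _
        · intro H n
          have := H (Nat.pair n (i n))
          simp only [Nat.unpair_pair, if_true] at this
          rw [hfh]
          exact this

end Universal
section Combi

/-- One-letter extension of finite sequences. -/
def Step (a b : List ℕ) : Prop := ∃ d, b = a ++ [d]

/-- Admissible block of a stream of finite sequences. -/
def Blk (R : ℕ → List ℕ → Prop) (y : ℕ → List ℕ) (a b : ℕ) : Prop :=
  a < b ∧ (∀ i, a ≤ i → i + 1 < b → Step (y i) (y (i + 1))) ∧ R (y a).length (y (b - 1))

/-- Existence of an infinite path from `m`. -/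
def InfP (r : ℕ → ℕ → Prop) (m : ℕ) : Prop :=
  ∃ h : ℕ → ℕ, h 0 = 0 ∧ StrictMono h ∧ ∀ k, r (m + h k) (m + h (k + 1))

/-- Position `m` is a forced cut. -/
def Mis (y : ℕ → List ℕ) (m : ℕ) : Prop := m = 0 ∨ ¬ Step (y (m - 1)) (y m)

/-- No mismatch after `m`. -/
def Legal (y : ℕ → List ℕ) (m : ℕ) : Prop := ∀ i, m ≤ i → Step (y i) (y (i + 1))

/-- Finite prefix of `x`. -/
def pre (x : ℕ → ℕ) (n : ℕ) : List ℕ := (List.range n).map x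

/-- Limit of an increasing sequence of finite sequences. -/
def limS (s : ℕ → List ℕ) (p : ℕ) : ℕ := (s (p + 1)).getD p 0

lemma pre_length (x : ℕ → ℕ) (n : ℕ) : (pre x n).length = n := by simp [pre]

lemma pre_succ (x : ℕ → ℕ) (n : ℕ) : pre x (n + 1) = pre x n ++ [x n] := by
  simp [pre, List.range_succ]

lemma step_pre (x : ℕ → ℕ) (n : ℕ) : Step (pre x n) (pre x (n + 1)) := ⟨x n, pre_succ x n⟩

lemma pre_eq_iff (x x' : ℕ → ℕ) (n : ℕ) : pre x n = pre x' n ↔ ∀ i < n, x i = x' i := by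
  simp [pre]

lemma limS_length {s : ℕ → List ℕ} (h : ∀ i, Step (s i) (s (i + 1))) (i : ℕ) :
    (s i).length = (s 0).length + i := by
  induction i with
  | zero => rfl
  | succ i ih =>
    obtain ⟨d, hd⟩ := h i
    rw [hd, List.length_append, ih]
    simp [add_assoc]

lemma limS_stable {s : ℕ → List ℕ} (h : ∀ i, Step (s i) (s (i + 1))) (i k p : ℕ)
    (hp : p < (s i).length) : (s (i + k)).getD p 0 = (s i).getD p 0 := by
  induction k with
  | zero => rfl
  | succ k ih =>
    obtain ⟨d, hd⟩ := h (i + k)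
    rw [← add_assoc, hd, ← ih]
    apply List.getD_append
    rw [limS_length h] at hp ⊢
    omega

lemma limS_spec {s : ℕ → List ℕ} (h : ∀ i, Step (s i) (s (i + 1))) (i : ℕ) :
    s i = pre (limS s) ((s 0).length + i) := by
  apply List.ext_getElem
  · rw [pre_length, limS_length h]
  · intro p h1 h2
    have e1 : (s i)[p] = (s i).getD p 0 := by simp [h1]
    have e2 : (pre (limS s) ((s 0).length + i))[p] = limS s p := by simp [pre]
    rw [e1, e2, limS]
    rcases le_total i (p + 1) with hle | hle
    · obtain ⟨k, hk⟩ := Nat.exists_eq_add_of_le hle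
      rw [hk, limS_stable h _ _ _ h1]
    · obtain ⟨k, hk⟩ := Nat.exists_eq_add_of_le hle
      rw [hk, limS_stable h _ _ _ (by rw [limS_length h]; omega)]

lemma limS_pre (x : ℕ → ℕ) : limS (pre x) = x := by
  funext p
  simp [limS, pre]

lemma infP_cons {r : ℕ → ℕ → Prop} (hr : ∀ a b, r a b → a < b) {a b : ℕ} (h : r a b)
    (hb : InfP r b) : InfP r a := by
  obtain ⟨f, h0, hm, hf⟩ := hb
  have hab := hr _ _ h
  refine ⟨fun k => match k with | 0 => 0 | k + 1 => b - a + f k, rfl, ?_, ?_⟩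
  · refine strictMono_nat_of_lt_succ fun k => ?_
    cases k with
    | zero => simp; omega
    | succ k => simpa using hm (Nat.lt_succ_self k)
  · intro k
    cases k with
    | zero => simpa [h0, Nat.add_sub_of_le hab.le] using h
    | succ k =>
      have e : ∀ j, a + (b - a + f j) = b + f j := by intro j; omega
      simpa [e] using hf k

lemma infP_of_rtg {r : ℕ → ℕ → Prop} (hr : ∀ a b, r a b → a < b) {a b : ℕ}
    (h : Relation.ReflTransGen r a b) (hb : InfP r b) : InfP r a := by
  induction h using Relation.ReflTransGen.head_induction_on with
  | refl => exact hb
  | head h _ ih => exact infP_cons hr h ih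

lemma infP_of_coind {r : ℕ → ℕ → Prop} (hr : ∀ a b, r a b → a < b) (Q : ℕ → Prop)
    (hQ : ∀ n, Q n → ∃ n', r n n' ∧ Q n') {a : ℕ} (ha : Q a) : InfP r a := by
  choose! g hg using hQ
  have hq : ∀ k, Q (g^[k] a) := by
    intro k
    induction k with
    | zero => exact ha
    | succ k ih => rw [Function.iterate_succ_apply']; exact (hg _ ih).2
  have hs : ∀ k, r (g^[k] a) (g^[k + 1] a) := by
    intro k
    rw [Function.iterate_succ_apply']; exact (hg _ (hq k)).1
  have hmono : StrictMono (fun k => g^[k] a) := strictMono_nat_of_lt_succ fun k => hr _ _ (hs k)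
  have hge : ∀ k, a ≤ g^[k] a := fun k => hmono.monotone (Nat.zero_le k)
  refine ⟨fun k => g^[k] a - a, by simp, fun i j hij => ?_, fun k => ?_⟩
  · have := hmono hij
    have := hge i
    simp only at *
    omega
  · rw [Nat.add_sub_of_le (hge k), Nat.add_sub_of_le (hge (k + 1))]
    exact hs k

variable {R : ℕ → List ℕ → Prop} {y : ℕ → List ℕ}

lemma blk_lt : ∀ a b, Blk R y a b → a < b := fun _ _ h => h.1

lemma rtg_le {a b : ℕ} (h : Relation.ReflTransGen (Blk R y) a b) : a ≤ b := by
  induction h with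
  | refl => exact le_rfl
  | tail _ h ih => exact ih.trans h.1.le

lemma blk_mis {a b m : ℕ} (h : Blk R y a b) (hm : Mis y m) (h1 : a < m) : b ≤ m := by
  by_contra hlt
  rcases hm with rfl | hm
  · omega
  · apply hm
    have := h.2.1 (m - 1) (by omega) (by omega)
    rwa [show m - 1 + 1 = m by omega] at this

lemma rtg_pass {n b m : ℕ} (h : Relation.ReflTransGen (Blk R y) n b) (hm : Mis y m)
    (h1 : n ≤ m) (h2 : m ≤ b) :
    Relation.ReflTransGen (Blk R y) n m ∧ Relation.ReflTransGen (Blk R y) m b := by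
  induction h with
  | refl =>
    obtain rfl : n = m := by omega
    exact ⟨.refl, .refl⟩
  | @tail c b hnc hcb ih =>
    rcases le_or_gt m c with hmc | hmc
    · obtain ⟨h3, h4⟩ := ih hmc
      exact ⟨h3, h4.tail hcb⟩
    · have := blk_mis hcb hm hmc
      obtain rfl : m = b := by omega
      exact ⟨hnc.tail hcb, .refl⟩

lemma infP_main : InfP (Blk R y) 0 ↔ ∀ m, Mis y m →
    Relation.ReflTransGen (Blk R y) 0 m ∧ (Legal y m → InfP (Blk R y) m) := by
  constructor
  · rintro ⟨h, h0, hmono, hblk⟩ m hm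
    simp only [zero_add] at hblk
    have hreach : ∀ k, Relation.ReflTransGen (Blk R y) 0 (h k) := by
      intro k
      induction k with
      | zero => rw [h0]
      | succ k ih => exact ih.tail (hblk k)
    obtain ⟨k, hk⟩ : ∃ k, m = h k := by
      have hex : ∃ k, m ≤ h k := ⟨m, hmono.le_apply⟩
      classical
      have hf := Nat.find_spec hex
      rcases hn : Nat.find hex with _ | k
      · rw [hn, h0] at hf
        exact ⟨0, by omega⟩
      · rw [hn] at hf
        have hlt : ¬ m ≤ h k := Nat.find_min hex (by omega)
        have := blk_mis (hblk k) hm (by omega)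
        exact ⟨k + 1, by omega⟩
    subst hk
    refine ⟨hreach k, fun _ => ⟨fun j => h (k + j) - h k, by simp, fun i j hij => ?_, fun j => ?_⟩⟩
    · have h1 := hmono (Nat.add_lt_add_left hij k)
      have h2 := hmono.monotone (Nat.le_add_right k i)
      simp only
      omega
    · rw [Nat.add_sub_of_le (hmono.monotone (Nat.le_add_right k j)),
        Nat.add_sub_of_le (hmono.monotone (Nat.le_add_right k (j + 1)))]
      exact hblk (k + j)
  · intro H
    by_cases hinf : ∀ N, ∃ m, N < m ∧ Mis y m
    · refine infP_of_coind blk_lt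
        (fun n => ∀ m, Mis y m → n ≤ m → Relation.ReflTransGen (Blk R y) n m) ?_
        (fun m hm _ => (H m hm).1)
      intro n hn
      obtain ⟨m, hnm, hm⟩ := hinf n
      rcases (hn m hm hnm.le).cases_head with h | ⟨n', h1, h2⟩
      · omega
      refine ⟨n', h1, fun m' hm' hle => ?_⟩
      rcases le_total m' m with hc | hc
      · exact (rtg_pass h2 hm' hle hc).1
      · exact h2.trans (rtg_pass (hn m' hm' (hnm.le.trans hc)) hm hnm.le hc).2
    · push Not at hinf
      classical
      obtain ⟨N, hN⟩ := hinf
      have hP : ∃ m ≤ N, Mis y m := ⟨0, Nat.zero_le _, Or.inl rfl⟩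
      have hs : Mis y (Nat.findGreatest (Mis y) N) :=
        Nat.findGreatest_spec (Nat.zero_le N) (Or.inl rfl)
      refine infP_of_rtg blk_lt (H _ hs).1 ((H _ hs).2 fun i hi => ?_)
      by_contra hst
      have hm : Mis y (i + 1) := Or.inr (by simpa using hst)
      have h1 : i + 1 ≤ N := by
        by_contra hlt
        exact hN (i + 1) (by omega) hm
      have := Nat.le_findGreatest h1 hm
      omega

lemma infP_legal {m : ℕ} (hL : Legal y m) : InfP (Blk R y) m ↔
    InfP (fun a b => R a (pre (limS fun i => y (m + i)) (b - 1))) (y m).length := by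
  have hs : ∀ i, Step (y (m + i)) (y (m + (i + 1))) := fun i => hL (m + i) (Nat.le_add_right _ _)
  have hlen := fun i => limS_length (s := fun i => y (m + i)) hs i
  have hspec := fun i => limS_spec (s := fun i => y (m + i)) hs i
  simp only [add_zero] at hlen hspec
  refine exists_congr fun h => and_congr_right fun h0 => and_congr_right fun hmono =>
    forall_congr' fun k => ?_
  have hk : h k < h (k + 1) := hmono (Nat.lt_succ_self k)
  have e1 : m + h (k + 1) - 1 = m + (h (k + 1) - 1) := by omega
  have e2 : (y m).length + h (k + 1) - 1 = (y m).length + (h (k + 1) - 1) := by omega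
  unfold Blk
  simp only [e1, e2, hlen]
  rw [hspec (h (k + 1) - 1)]
  constructor
  · exact fun h => h.2.2
  · exact fun h => ⟨by omega, fun i hi _ => hL i (by omega), h⟩

/-- Decoding of letters. -/
def dec (n : ℕ) : List ℕ := Denumerable.ofNat (List ℕ) n

/-- The language over `ℕ`. -/
def langA (R : ℕ → List ℕ → Prop) : Set (List ℕ) := {w | w ≠ [] ∧
  (∀ i, i + 1 < w.length → Step (dec (w.getD i 0)) (dec (w.getD (i + 1) 0))) ∧
  R (dec (w.getD 0 0)).length (dec (w.getD (w.length - 1) 0))}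

lemma langA_block (v : ℕ → ℕ) {a b : ℕ} (hab : a < b) :
    (List.ofFn fun i : Fin (b - a) => v (a + i.val)) ∈ langA R ↔
      Blk R (fun n => dec (v n)) a b := by
  have hget : ∀ i, i < b - a →
      (List.ofFn fun i : Fin (b - a) => v (a + i.val)).getD i 0 = v (a + i) := by
    intro i hi
    simp [List.getD_eq_getElem?_getD, hi]
  unfold langA Blk
  rw [Set.mem_ofPred_eq, List.length_ofFn, hget 0 (by omega), hget (b - a - 1) (by omega),
    show a + (b - a - 1) = b - 1 by omega, add_zero]
  have hne : (List.ofFn fun i : Fin (b - a) => v (a + i.val)) ≠ [] := by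
    intro h
    have := congrArg List.length h
    simp at this
    omega
  constructor
  · rintro ⟨_, h2, h3⟩
    refine ⟨hab, fun i h4 h5 => ?_, h3⟩
    have := h2 (i - a) (by omega)
    rw [hget _ (by omega), hget _ (by omega)] at this
    rwa [show a + (i - a) = i by omega, show a + (i - a + 1) = i + 1 by omega] at this
  · rintro ⟨_, h2, h3⟩
    refine ⟨hne, fun i h4 => ?_, h3⟩
    rw [hget _ (by omega), hget _ (by omega)]
    exact h2 (a + i) (by omega) (by omega)

lemma omegaPower_langA (v : ℕ → ℕ) :
    v ∈ omegaPower (langA R) ↔ InfP (Blk R fun n => dec (v n)) 0 := by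
  unfold omegaPower InfP
  rw [Set.mem_ofPred_eq]
  refine exists_congr fun f => and_congr_right fun _ => and_congr_right fun hm =>
    forall_congr' fun k => ?_
  rw [langA_block v (hm (Nat.lt_succ_self k)), zero_add, zero_add]

lemma isClopen_of_dep {P : (ℕ → ℕ) → Prop} (N : ℕ)
    (h : ∀ v v', (∀ i < N, v i = v' i) → P v → P v') : IsClopen {v | P v} := by
  have key : ∀ Q : (ℕ → ℕ) → Prop, (∀ v v', (∀ i < N, v i = v' i) → Q v → Q v') →
      IsOpen {v | Q v} := by
    intro Q hQ
    rw [isOpen_iff_mem_nhds]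
    intro v hv
    have : (⋂ i ∈ Finset.range N, (fun v' : ℕ → ℕ => v' i) ⁻¹' {v i}) ∈ nhds v := by
      refine IsOpen.mem_nhds (isOpen_biInter_finset fun i _ =>
        (isOpen_discrete {v i}).preimage (continuous_apply i)) ?_
      simp
    filter_upwards [this] with v' hv'
    simp only [Set.mem_iInter, Finset.mem_range, Set.mem_preimage, Set.mem_singleton_iff] at hv'
    exact hQ v v' (fun i hi => (hv' i hi).symm) hv
  refine ⟨?_, key P h⟩
  rw [← isOpen_compl_iff]
  exact key (fun v => ¬ P v) fun v v' hvv hv hv' => hv (h v' v (fun i hi => (hvv i hi).symm) hv')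

lemma blk_congr {y y' : ℕ → List ℕ} {a b : ℕ} (h : ∀ i < b, y i = y' i) (hb : Blk R y a b) :
    Blk R y' a b := by
  obtain ⟨h1, h2, h3⟩ := hb
  refine ⟨h1, fun i hi hib => ?_, ?_⟩
  · rw [← h i (by omega), ← h (i + 1) hib]
    exact h2 i hi hib
  · rw [← h a h1, ← h (b - 1) (by omega)]
    exact h3

lemma rtg_congr {y y' : ℕ → List ℕ} {a b : ℕ} (h : ∀ i < b, y i = y' i)
    (hb : Relation.ReflTransGen (Blk R y) a b) : Relation.ReflTransGen (Blk R y') a b := by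
  induction hb with
  | refl => exact .refl
  | tail h1 h2 ih =>
    exact (ih fun i hi => h i (hi.trans h2.1)).tail (blk_congr h h2)

lemma mis_congr {y y' : ℕ → List ℕ} {m : ℕ} (h : ∀ i < m + 1, y i = y' i)
    (hb : Mis y m) : Mis y' m := by
  unfold Mis at *
  rwa [← h (m - 1) (by omega), ← h m (by omega)]

lemma pi_langA {ξ : Ordinal.{0}} (hξ : 1 < ξ)
    (hR : ∀ j, PiO ξ {x : ℕ → ℕ | InfP (fun a b => R a (pre x (b - 1))) j}) :
    PiO ξ (omegaPower (langA R)) := by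
  let S1 : ℕ → Set (ℕ → ℕ) := fun m => {v | Mis (fun n => dec (v n)) m →
    Relation.ReflTransGen (Blk R fun n => dec (v n)) 0 m}
  let lm : ℕ → (ℕ → ℕ) → (ℕ → ℕ) := fun m v => limS fun i => dec (v (m + i))
  let K : ℕ → ℕ → Set (ℕ → ℕ) := fun m a => {v | Mis (fun n => dec (v n)) m} ∩
    ({v | Legal (fun n => dec (v n)) m} ∩ {v | v m = a})
  let B : ℕ → Set (ℕ → ℕ) := fun j => {x | InfP (fun a b => R a (pre x (b - 1))) j}
  have hEq : omegaPower (langA R) =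
      ⋂ m, (S1 m ∩ ⋂ a, (K m a ∩ lm m ⁻¹' (B (dec a).length)ᶜ)ᶜ) := by
    ext v
    rw [omegaPower_langA, infP_main]
    simp only [Set.mem_iInter, Set.mem_inter_iff, S1, K, B, lm, Set.mem_ofPred_eq, Set.mem_compl_iff,
      Set.mem_preimage]
    refine forall_congr' fun m => ?_
    constructor
    · intro h
      refine ⟨fun hm => (h hm).1, fun a => ?_⟩
      rintro ⟨⟨hm, hL, rfl⟩, h2⟩
      exact h2 ((infP_legal (R := R) hL).1 ((h hm).2 hL))
    · rintro ⟨h1, h2⟩ hm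
      refine ⟨h1 hm, fun hL => ?_⟩
      rw [infP_legal (R := R) hL]
      by_contra hcon
      exact h2 (v m) ⟨⟨hm, hL, rfl⟩, hcon⟩
  rw [hEq]
  refine pi_iInter fun m => pi_inter ?_ (pi_iInter fun a => ?_)
  · have hc : IsClopen (S1 m) := by
      refine isClopen_of_dep (m + 1) fun v v' hvv hv hm => ?_
      have h1 : ∀ i < m + 1, dec (v i) = dec (v' i) := fun i hi => by rw [hvv i hi]
      exact rtg_congr (fun i hi => h1 i (by omega)) (hv (mis_congr (fun i hi => (h1 i hi).symm) hm))
    exact sig_mono (sig_one_iff.2 hc.1.isOpen_compl) hξ.le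
  · unfold PiO
    rw [compl_compl]
    refine sig_inter_closed hξ (sig_preimage (hR _) ?_) ?_
    · refine continuous_pi fun p => ?_
      exact (continuous_of_discreteTopology (f := fun n : ℕ => (dec n).getD p 0)).comp
        (continuous_apply (m + (p + 1)))
    · refine IsClosed.inter ?_ (IsClosed.inter ?_ ?_)
      · refine (isClopen_of_dep (m + 1) fun v v' hvv hm => ?_).1
        exact mis_congr (fun i hi => by rw [hvv i hi]) hm
      · have : {v : ℕ → ℕ | Legal (fun n => dec (v n)) m} =
            ⋂ i : ℕ, {v : ℕ → ℕ | m ≤ i → Step (dec (v i)) (dec (v (i + 1)))} := by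
          ext v; simp [Legal]
        rw [this]
        refine isClosed_iInter fun i => (isClopen_of_dep (i + 2) fun v v' hvv h hm => ?_).1
        rw [← hvv i (by omega), ← hvv (i + 1) (by omega)]
        exact h hm
      · exact (isClopen_of_dep (m + 1) fun v v' hvv h => by rw [← hvv m (by omega)]; exact h).1

/-- Coding the stream of prefixes. -/
def prefStream (x : ℕ → ℕ) (n : ℕ) : ℕ := Encodable.encode (pre x n)

lemma dec_prefStream (x : ℕ → ℕ) (n : ℕ) : dec (prefStream x n) = pre x n := by
  simp [dec, prefStream]

lemma continuous_prefStream : Continuous prefStream := by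
  refine continuous_pi fun n => ?_
  refine IsLocallyConstant.continuous ?_
  intro s
  refine (isClopen_of_dep (P := fun x => prefStream x n ∈ s) n fun v v' h hv => ?_).2
  have : pre v n = pre v' n := (pre_eq_iff _ _ _).2 h
  unfold prefStream at *
  rwa [← this]

lemma mem_prefStream (x : ℕ → ℕ) : prefStream x ∈ omegaPower (langA R) ↔
    InfP (fun a b => R a (pre x (b - 1))) 0 := by
  rw [omegaPower_langA]
  simp only [dec_prefStream]
  have hL : Legal (fun n => pre x n) 0 := fun i _ => step_pre x i
  rw [infP_legal hL]
  simp only [zero_add, pre_length]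
  rw [limS_pre]

/-- State enumeration. -/
def stt (n : ℕ) : List ℕ := if n = 0 then [] else dec n.unpair.1

lemma exists_stt (s : List ℕ) (N : ℕ) : ∃ n, N < n ∧ stt n = s := by
  refine ⟨Nat.pair (Encodable.encode s) (N + 1), ?_, ?_⟩
  · have := Nat.right_le_pair (Encodable.encode s) (N + 1)
    omega
  · have := Nat.right_le_pair (Encodable.encode s) (N + 1)
    rw [stt, if_neg (by omega)]
    simp [dec]

/-- The transition relation attached to a closed set. -/
def relC (C : Set ((ℕ → ℕ) × (ℕ → ℕ))) (j : ℕ) (σ : List ℕ) : Prop :=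
  Step (stt j) (stt (σ.length + 1)) ∧ ∃ x z, (x, z) ∈ C ∧ pre x σ.length = σ ∧
    pre z (stt (σ.length + 1)).length = stt (σ.length + 1)

lemma infP_relC {C : Set ((ℕ → ℕ) × (ℕ → ℕ))} (hC : IsClosed C) (j : ℕ) (x : ℕ → ℕ) :
    InfP (fun a b => relC C a (pre x (b - 1))) j ↔
      ∃ z, pre z (stt j).length = stt j ∧ (x, z) ∈ C := by
  constructor
  · rintro ⟨h, h0, hmono, hrel⟩
    have hb : ∀ k, j + h (k + 1) - 1 + 1 = j + h (k + 1) := by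
      intro k
      have := hmono (Nat.lt_succ_self k)
      simp only [Nat.succ_eq_add_one] at this
      omega
    unfold relC at hrel
    simp only [pre_length, hb] at hrel
    let s : ℕ → List ℕ := fun k => stt (j + h k)
    have hs : ∀ k, Step (s k) (s (k + 1)) := fun k => (hrel k).1
    have hspec := fun k => limS_spec hs k
    have hlen := fun k => limS_length hs k
    have hs0 : s 0 = stt j := by simp [s, h0]
    refine ⟨limS s, ?_, ?_⟩
    · have := hspec 0
      rw [add_zero, hs0] at this
      exact this.symm
    · choose _ X Z hXZ hX hZ using hrel
      refine hC.mem_of_tendsto (f := fun k => (X k, Z k)) (b := Filter.atTop) ?_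
        (Filter.Eventually.of_forall hXZ)
      refine Filter.Tendsto.prodMk_nhds ?_ ?_
      · rw [tendsto_pi_nhds]
        intro i
        apply tendsto_const_nhds.congr'
        filter_upwards [Filter.eventually_gt_atTop i] with k hk
        have h2 : k + 1 ≤ h (k + 1) := hmono.le_apply
        exact ((pre_eq_iff _ _ _).1 (hX k) i (by omega)).symm
      · rw [tendsto_pi_nhds]
        intro i
        apply tendsto_const_nhds.congr'
        filter_upwards [Filter.eventually_gt_atTop i] with k hk
        have h1 : pre (Z k) (s (k + 1)).length = s (k + 1) := hZ k
        rw [hlen, hspec (k + 1), pre_eq_iff] at h1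
        exact (h1 i (by omega)).symm
  · rintro ⟨z, hz, hC⟩
    refine infP_of_coind (r := fun a b => a < b ∧ relC C a (pre x (b - 1)))
      (fun a b h => h.1) (fun n => pre z (stt n).length = stt n) ?_ hz |>.imp
        fun h hh => ⟨hh.1, hh.2.1, fun k => (hh.2.2 k).2⟩
    intro n hn
    obtain ⟨m, hm, hms⟩ := exists_stt (pre z ((stt n).length + 1)) n
    have e : m - 1 + 1 = m := by omega
    refine ⟨m, ⟨hm, ?_⟩, by rw [hms, pre_length]⟩
    unfold relC
    rw [pre_length, e, hms]
    refine ⟨?_, x, z, hC, rfl, by rw [pre_length]⟩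
    have := step_pre z (stt n).length
    rwa [hn] at this

/-- A `Π⁰_ξ` set of the Baire space reduces to a `Π⁰_ξ` ω-power over `ℕ`. -/
lemma exists_lang_nat {ξ : Ordinal.{0}} (hξ : 1 < ξ) (W : Set (ℕ → ℕ)) (hW : PiO ξ W) :
    ∃ A : Set (List ℕ), PiO ξ (omegaPower A) ∧ (∀ w ∈ A, w ≠ []) ∧
      ∃ f : (ℕ → ℕ) → (ℕ → ℕ), Continuous f ∧ W = f ⁻¹' omegaPower A := by
  obtain ⟨C, hC, hWC, hS⟩ := pi_rep ξ W hW
  refine ⟨langA (relC C), pi_langA hξ fun j => ?_, fun w hw => hw.1, prefStream,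
    continuous_prefStream, ?_⟩
  · have := hS (Set.Iio (stt j).length) (fun i => (stt j).getD i 0) (isLowerSet_Iio _)
    convert this using 1
    ext x
    simp only [Set.mem_ofPred_eq]
    rw [infP_relC hC]
    refine exists_congr fun z => and_congr_left fun _ => ?_
    constructor
    · intro h i hi
      rw [← h]
      have : i < (stt j).length := hi
      simp [pre, this]
    · intro h
      apply List.ext_getElem
      · rw [pre_length]
      · intro i h1 h2
        have := h i h2
        rw [List.getD_eq_getElem _ _ h2] at this
        simp [pre, this]
  · ext x
    rw [Set.mem_preimage, mem_prefStream, infP_relC hC, hWC]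
    simp [stt, pre]

end Combi
section Coding

/-- Starting position of the `n`-th letter code. -/
def ps (y : ℕ → ℕ) : ℕ → ℕ
  | 0 => 0
  | n + 1 => ps y n + (y n + 1)

open Classical in
/-- Binary coding of a stream of natural numbers. -/
noncomputable def enc (y : ℕ → ℕ) (t : ℕ) : Bool := decide (∃ n, ps y (n + 1) = t + 1)

/-- Binary coding of finite sequences. -/
def cod (w : List ℕ) : List Bool := w.flatMap fun k => List.replicate k false ++ [true]

/-- Finite factor. -/
def seg {α : Type*} (x : ℕ → α) (a b : ℕ) : List α := (List.range (b - a)).map fun i => x (a + i)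

lemma ofFn_eq_seg {α : Type*} (x : ℕ → α) (a b : ℕ) :
    (List.ofFn fun i : Fin (b - a) => x (a + i.val)) = seg x a b := by
  apply List.ext_getElem <;> simp [seg]

lemma seg_append {α : Type*} (x : ℕ → α) {a b c : ℕ} (h1 : a ≤ b) (h2 : b ≤ c) :
    seg x a c = seg x a b ++ seg x b c := by
  unfold seg
  rw [show c - a = (b - a) + (c - b) by omega, List.range_add, List.map_append, List.map_map]
  congr 1
  refine List.map_congr_left fun i _ => ?_
  simp only [Function.comp]
  congr 1
  omega

lemma ps_strictMono (y : ℕ → ℕ) : StrictMono (ps y) :=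
  strictMono_nat_of_lt_succ fun n => by simp only [ps]; omega

lemma enc_true {y : ℕ → ℕ} {t : ℕ} : enc y t = true ↔ ∃ n, ps y (n + 1) = t + 1 := by
  simp [enc]

lemma enc_seg_one (y : ℕ → ℕ) (n : ℕ) :
    seg (enc y) (ps y n) (ps y (n + 1)) = List.replicate (y n) false ++ [true] := by
  unfold seg
  rw [show ps y (n + 1) - ps y n = y n + 1 by simp [ps], List.range_succ, List.map_append]
  congr 1
  · rw [List.eq_replicate_iff]
    refine ⟨by simp, ?_⟩
    intro b hb
    rw [List.mem_map] at hb
    obtain ⟨i, hi, rfl⟩ := hb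
    rw [List.mem_range] at hi
    rw [Bool.eq_false_iff]
    intro h
    obtain ⟨k, hk⟩ := enc_true.1 h
    have h1 : n < k + 1 := (ps_strictMono y).lt_iff_lt.1 (by omega)
    have h2 : k + 1 < n + 1 := (ps_strictMono y).lt_iff_lt.1 (by simp only [ps] at *; omega)
    omega
  · simp only [List.map_cons, List.map_nil]
    congr 1
    exact enc_true.2 ⟨n, by simp [ps]; omega⟩

lemma enc_seg (y : ℕ → ℕ) {a b : ℕ} (h : a ≤ b) :
    seg (enc y) (ps y a) (ps y b) = cod (seg y a b) := by
  induction b, h using Nat.le_induction with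
  | base => simp [seg, cod]
  | succ b hab ih =>
    rw [seg_append (enc y) ((ps_strictMono y).monotone hab)
      ((ps_strictMono y).monotone (Nat.le_succ b)), ih, enc_seg_one,
      seg_append y hab (Nat.le_succ b)]
    simp [cod, seg]

lemma cod_cons (a : ℕ) (w : List ℕ) : cod (a :: w) = List.replicate a false ++ true :: cod w := by
  simp [cod]

lemma repl_inj (a b : ℕ) (u v : List Bool)
    (h : List.replicate a false ++ true :: u = List.replicate b false ++ true :: v) :
    a = b ∧ u = v := by
  induction a generalizing b with
  | zero =>
    cases b with
    | zero => simpa using h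
    | succ b => simp [List.replicate_succ] at h
  | succ a ih =>
    cases b with
    | zero => simp [List.replicate_succ] at h
    | succ b =>
      simp only [List.replicate_succ, List.cons_append, List.cons.injEq, true_and] at h
      obtain ⟨h1, h2⟩ := ih b h
      exact ⟨by omega, h2⟩

lemma cod_inj : Function.Injective cod := by
  intro w
  induction w with
  | nil =>
    intro w' h
    cases w' with
    | nil => rfl
    | cons a w' => rw [cod_cons] at h; simp [cod] at h
  | cons a w ih =>
    intro w' h
    cases w' with
    | nil => rw [cod_cons] at h; simp [cod] at h
    | cons b w' =>
      rw [cod_cons, cod_cons] at h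
      obtain ⟨rfl, h2⟩ := repl_inj _ _ _ _ h
      rw [ih h2]

lemma cod_last {w : List ℕ} (hw : w ≠ []) : (cod w).getLast? = some true := by
  obtain ⟨u, a, rfl⟩ := List.eq_nil_or_concat w |>.resolve_left hw
  simp [cod]

lemma enc_surj (b : ℕ → Bool) (hb : ∀ N, ∃ t, N ≤ t ∧ b t = true) : ∃ y, enc y = b := by
  have hinf : {t | b t = true}.Infinite := by
    rw [Set.infinite_iff_exists_gt]
    intro N
    obtain ⟨t, h1, h2⟩ := hb (N + 1)
    exact ⟨t, h2, by omega⟩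
  let q : ℕ → ℕ := Nat.nth fun t => b t = true
  have hq : StrictMono q := Nat.nth_strictMono hinf
  refine ⟨fun n => match n with | 0 => q 0 | n + 1 => q (n + 1) - q n - 1, ?_⟩
  set y : ℕ → ℕ := fun n => match n with | 0 => q 0 | n + 1 => q (n + 1) - q n - 1 with hy
  have hp : ∀ n, ps y (n + 1) = q n + 1 := by
    intro n
    induction n with
    | zero => simp [ps, hy]
    | succ n ih =>
      have := hq (Nat.lt_succ_self n)
      rw [ps, ih]
      simp only [hy]
      simp only [Nat.succ_eq_add_one] at this
      omega
  funext t
  rw [Bool.eq_iff_iff, enc_true]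
  simp only [hp, Nat.add_right_cancel_iff]
  constructor
  · rintro ⟨n, rfl⟩
    exact Nat.nth_mem_of_infinite hinf n
  · intro h
    have : t ∈ Set.range q := by
      rw [Nat.range_nth_of_infinite hinf]; exact h
    exact this

lemma enc_frequent (y : ℕ → ℕ) (N : ℕ) : ∃ t, N ≤ t ∧ enc y t = true := by
  have h1 : N + 1 ≤ ps y (N + 1) := (ps_strictMono y).le_apply
  exact ⟨ps y (N + 1) - 1, by omega, enc_true.2 ⟨N, by omega⟩⟩

lemma omegaPower_cod (A : Set (List ℕ)) (hA : ∀ w ∈ A, w ≠ []) :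
    omegaPower (cod '' A) = enc '' omegaPower A := by
  ext b
  constructor
  · rintro ⟨f, h0, hm, hf⟩
    simp only [ofFn_eq_seg] at hf
    have hlast : ∀ k, b (f (k + 1) - 1) = true := by
      intro k
      obtain ⟨w, hw, hwe⟩ := hf k
      have h1 := cod_last (hA w hw)
      have h2 : f k < f (k + 1) := hm (Nat.lt_succ_self k)
      rw [hwe] at h1
      have e : seg b (f k) (f (k + 1)) = seg b (f k) (f (k + 1) - 1) ++ [b (f (k + 1) - 1)] := by
        rw [seg_append b (show f k ≤ f (k + 1) - 1 by omega)
          (show f (k + 1) - 1 ≤ f (k + 1) by omega)]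
        congr 1
        simp [seg, show f (k + 1) - (f (k + 1) - 1) = 1 by omega]
      rw [e] at h1
      simpa using h1
    obtain ⟨y, rfl⟩ := enc_surj b fun N => ⟨f (N + 1) - 1, by
      have : N + 1 ≤ f (N + 1) := hm.le_apply
      omega, hlast N⟩
    have hg : ∀ k, ∃ n, ps y n = f k := by
      intro k
      cases k with
      | zero => exact ⟨0, by rw [h0]; rfl⟩
      | succ k =>
        obtain ⟨n, hn⟩ := enc_true.1 (hlast k)
        have : k + 1 ≤ f (k + 1) := hm.le_apply
        exact ⟨n + 1, by omega⟩
    choose g hg using hg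
    have hgm : StrictMono g := by
      intro i j hij
      rw [← (ps_strictMono y).lt_iff_lt, hg, hg]
      exact hm hij
    refine ⟨y, ⟨g, ?_, hgm, fun k => ?_⟩, rfl⟩
    · apply (ps_strictMono y).injective
      rw [hg, h0]; rfl
    · rw [ofFn_eq_seg]
      obtain ⟨w, hw, hwe⟩ := hf k
      rw [← hg, ← hg, enc_seg y (hgm (Nat.lt_succ_self k)).le] at hwe
      rw [← cod_inj hwe]
      exact hw
  · rintro ⟨y, ⟨f, h0, hm, hf⟩, rfl⟩
    refine ⟨fun k => ps y (f k), by simp [h0, ps], (ps_strictMono y).comp hm, fun k => ?_⟩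
    rw [ofFn_eq_seg, enc_seg y (hm (Nat.lt_succ_self k)).le, ← ofFn_eq_seg]
    exact ⟨_, hf k, rfl⟩

lemma ps_congr {y y' : ℕ → ℕ} {n : ℕ} (h : ∀ i < n, y i = y' i) : ps y n = ps y' n := by
  induction n with
  | zero => rfl
  | succ n ih => rw [ps, ps, ih fun i hi => h i (by omega), h n (by omega)]

lemma continuous_enc : Continuous enc := by
  refine continuous_pi fun t => ?_
  refine IsLocallyConstant.continuous fun s => ?_
  refine (isClopen_of_dep (P := fun y => enc y t ∈ s) (t + 1) fun v v' h hv => ?_).2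
  have key : ∀ v v' : ℕ → ℕ, (∀ i < t + 1, v i = v' i) → enc v t = true → enc v' t = true := by
    intro v v' h hv
    obtain ⟨n, hn⟩ := enc_true.1 hv
    have : n + 1 ≤ ps v (n + 1) := (ps_strictMono v).le_apply
    refine enc_true.2 ⟨n, ?_⟩
    rw [← hn]
    exact (ps_congr fun i hi => h i (by omega)).symm
  have : enc v t = enc v' t := by
    rw [Bool.eq_iff_iff]
    exact ⟨key v v' h, key v' v fun i hi => (h i hi).symm⟩
  rwa [← this]

lemma enc_determines (y y' : ℕ → ℕ) (n : ℕ) (h : ∀ t < ps y n, enc y' t = enc y t) :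
    ∀ i < n, y' i = y i := by
  induction n with
  | zero => intro i hi; omega
  | succ n ih =>
    have hlt := ps_strictMono y (Nat.lt_succ_self n)
    have hlt' := ps_strictMono y' (Nat.lt_succ_self n)
    have h1 := ih fun t ht => h t (ht.trans hlt)
    have h2 : ps y' n = ps y n := ps_congr h1
    have e := enc_seg_one y n
    simp only [Nat.succ_eq_add_one] at hlt hlt'
    have hle : ps y' (n + 1) ≤ ps y (n + 1) := by
      have : enc y' (ps y (n + 1) - 1) = true := by
        rw [h _ (by omega)]
        exact enc_true.2 ⟨n, by omega⟩
      obtain ⟨k, hk⟩ := enc_true.1 this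
      have hk' : ps y' (k + 1) = ps y (n + 1) := by omega
      have : n < k + 1 := (ps_strictMono y').lt_iff_lt.1 (by omega)
      rw [← hk']
      exact (ps_strictMono y').monotone (by omega)
    have hge : ps y (n + 1) ≤ ps y' (n + 1) := by
      have : enc y (ps y' (n + 1) - 1) = true := by
        rw [← h _ (by omega)]
        exact enc_true.2 ⟨n, by omega⟩
      obtain ⟨k, hk⟩ := enc_true.1 this
      have hk' : ps y (k + 1) = ps y' (n + 1) := by omega
      have : n < k + 1 := (ps_strictMono y).lt_iff_lt.1 (by omega)
      rw [← hk']
      exact (ps_strictMono y).monotone (by omega)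
    intro i hi
    rcases Nat.lt_succ_iff_lt_or_eq.1 hi with hi | rfl
    · exact h1 i hi
    · simp only [ps] at hle hge
      omega

lemma open_contains_cyl {U : Set (ℕ → ℕ)} (hU : IsOpen U) {y : ℕ → ℕ} (hy : y ∈ U) :
    ∃ n, ∀ y', (∀ i < n, y' i = y i) → y' ∈ U := by
  by_contra hcon
  push Not at hcon
  choose w hw hwU using hcon
  have : Filter.Tendsto w Filter.atTop (nhds y) := by
    rw [tendsto_pi_nhds]
    intro i
    apply tendsto_const_nhds.congr'
    filter_upwards [Filter.eventually_gt_atTop i] with n hn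
    exact (hw n i hn).symm
  obtain ⟨n, hn⟩ := (this.eventually (hU.mem_nhds hy)).exists
  exact hwU n hn

lemma enc_open (U : Set (ℕ → ℕ)) (hU : IsOpen U) :
    ∃ V : Set (ℕ → Bool), IsOpen V ∧ enc ⁻¹' V = U := by
  choose! n hn using fun y (hy : y ∈ U) => open_contains_cyl hU hy
  refine ⟨⋃ y ∈ U, ⋂ t ∈ Finset.range (ps y (n y)), (fun b : ℕ → Bool => b t) ⁻¹' {enc y t}, ?_, ?_⟩
  · refine isOpen_biUnion fun y _ => isOpen_biInter_finset fun t _ =>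
      (isOpen_discrete _).preimage (continuous_apply t)
  · ext y'
    simp only [Set.mem_preimage, Set.mem_iUnion, Set.mem_iInter, Finset.mem_range,
      Set.mem_singleton_iff]
    constructor
    · rintro ⟨y, hy, h⟩
      exact hn y hy y' (enc_determines y y' _ h)
    · intro h
      exact ⟨y', h, fun _ _ => rfl⟩

lemma pi_range_enc {ξ : Ordinal.{0}} (hξ : 1 < ξ) : PiO ξ (Set.range enc) := by
  have : Set.range enc = ⋂ N : ℕ, ⋃ t : ℕ, {b : ℕ → Bool | N ≤ t ∧ b t = true} := by
    ext b
    simp only [Set.mem_range, Set.mem_iInter, Set.mem_iUnion, Set.mem_ofPred_eq]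
    constructor
    · rintro ⟨y, rfl⟩; exact enc_frequent y
    · exact enc_surj b
  rw [this]
  refine pi_iInter fun N => pi_of_sig_lt (sig_one_iff.2 (isOpen_iUnion fun t => ?_)) hξ
  by_cases h : N ≤ t
  · simp only [h, true_and]
    exact (isOpen_discrete ({true} : Set Bool)).preimage
      (f := fun b : ℕ → Bool => b t) (continuous_apply t)
  · simp [h]

lemma transfer {ξ : Ordinal.{0}} (hξ : 1 < ξ) (A : Set (List ℕ)) (hA : ∀ w ∈ A, w ≠ [])
    (hP : PiO ξ (omegaPower A)) :
    PiO ξ (omegaPower (cod '' A)) ∧ enc ⁻¹' omegaPower (cod '' A) = omegaPower A := by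
  obtain ⟨t, ht, hte⟩ := sig_extend enc_open hP
  have hinj : Function.Injective enc := by
    intro y y' h
    funext i
    exact (enc_determines y y' (i + 1) (fun t _ => by rw [h]) i (by omega)).symm
  rw [omegaPower_cod A hA]
  refine ⟨?_, hinj.preimage_image _⟩
  have hEq : enc '' omegaPower A = tᶜ ∩ Set.range enc := by
    rw [← Set.image_preimage_eq_inter_range, Set.preimage_compl, hte, compl_compl]
  rw [hEq]
  refine pi_inter ?_ (pi_range_enc hξ)
  unfold PiO
  rwa [compl_compl]

end Coding

lemma omegaPower_false : omegaPower {[false]} = {fun _ : ℕ => false} := by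
  ext x
  rw [Set.mem_singleton_iff]
  constructor
  · rintro ⟨f, h0, hm, hf⟩
    have hlen : ∀ k, f (k + 1) = f k + 1 := by
      intro k
      have := congrArg List.length (Set.mem_singleton_iff.1 (hf k))
      simp at this
      omega
    have hk : ∀ k, f k = k := by
      intro k
      induction k with
      | zero => exact h0
      | succ k ih => rw [hlen, ih]
    funext k
    have := Set.mem_singleton_iff.1 (hf k)
    rw [ofFn_eq_seg] at this
    simpa [seg, hk] using this
  · rintro rfl
    refine ⟨id, rfl, strictMono_id, fun k => ?_⟩
    rw [ofFn_eq_seg (fun _ => false)]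
    simp [seg]


/-- For each non-null countable ordinal `ξ` there is a language `A ⊆ 2^{<ω}` whose ω-power
is a `Π⁰_ξ`-complete subset of Cantor space: `A^ω ∈ Π⁰_ξ(2^ω)` and every `Π⁰_ξ` subset of
`Y^ω`, for a finite alphabet `Y`, is the preimage of `A^ω` under some continuous map. -/
theorem exists_pi_complete_omegaPower (ξ : Ordinal.{0}) (hξ : ξ ≠ 0)
    (hcount : ξ.card ≤ Cardinal.aleph0) :
    ∃ A : Set (List Bool),
      PiO ξ (omegaPower A) ∧
      ∀ (Y : Type) [Fintype Y] [TopologicalSpace Y] [DiscreteTopology Y]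
        (E : Set (ℕ → Y)), PiO ξ E →
          ∃ f : (ℕ → Y) → (ℕ → Bool), Continuous f ∧ E = f ⁻¹' omegaPower A := by
  rcases (Order.one_le_iff_ne_zero.2 hξ).eq_or_lt with rfl | h1
  · refine ⟨{[false]}, ?_, ?_⟩
    · rw [omegaPower_false]
      exact sig_one_iff.2 isClosed_singleton.isOpen_compl
    · intro Y _ _ _ E hE
      rw [omegaPower_false]
      exact closed_complete (Bool.false_ne_true) Y E (isOpen_compl_iff.1 (sig_one_iff.1 hE))
  · obtain ⟨W, _, hW, hU⟩ := exists_universal ξ hξ hcount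
    obtain ⟨A, hA, hne, g, hg, hWg⟩ := exists_lang_nat h1 W hW
    obtain ⟨h2, h3⟩ := transfer h1 A hne hA
    refine ⟨cod '' A, h2, ?_⟩
    intro Y _ _ _ E hE
    obtain ⟨f, hf, hEf⟩ := hU Y E hE
    refine ⟨enc ∘ g ∘ f, continuous_enc.comp (hg.comp hf), ?_⟩
    rw [Set.preimage_comp, h3, Set.preimage_comp, ← hWg, hEf]
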